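/- (Degenerate addition formula for the Kronecker function.) For all z, u₁, u₂ ∈ ℂ such that z, u₁, u₂, u₁+u₂, z+u₁+u₂ lie outside the lattice Λ: φ(z, u₁)·φ(z, u₂) = φ(z, u₁+u₂)·( E₁(z) + E₁(u₁) + E₁(u₂) − E₁(z+u₁+u₂) ). -/

import Mathlib

open Complex Matrix Kronecker Finset Filter Topology

noncomputable section

/-- The lattice Λ = ℤ + τℤ. -/
def Lam (τ : ℂ) : Set ℂ := {z : ℂ | ∃ m n : ℤ, z = (m : ℂ) + (n : ℂ) * τ}

/-- The first Jacobi theta function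
ϑ(z) = −∑_{j∈ℤ} exp(πi(j+1/2)²τ + 2πi(j+1/2)(z+1/2)). -/
def theta (τ : ℂ) (z : ℂ) : ℂ :=
  -∑' j : ℤ, Complex.exp ((Real.pi : ℂ) * Complex.I * ((j : ℂ) + 1 / 2) ^ 2 * τ +
      2 * (Real.pi : ℂ) * Complex.I * ((j : ℂ) + 1 / 2) * (z + 1 / 2))

/-- The first Eisenstein function E₁(u) = ϑ′(u)/ϑ(u). -/
def E1 (τ : ℂ) (u : ℂ) : ℂ := deriv (theta τ) u / theta τ u

/-- The Kronecker function φ(z,u) = ϑ′(0)·ϑ(z+u)/(ϑ(z)·ϑ(u)). -/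
def phi (τ : ℂ) (z u : ℂ) : ℂ :=
  deriv (theta τ) 0 * theta τ (z + u) / (theta τ z * theta τ u)

/-- The second Eisenstein function E₂(u) = −E₁′(u). -/
def E2 (τ : ℂ) (u : ℂ) : ℂ := -deriv (E1 τ) u

/-- The Weierstrass ℘-function: ℘(u) = E₂(u) + (1/3)·ϑ‴(0)/ϑ′(0). -/
def wp (τ : ℂ) (u : ℂ) : ℂ :=
  E2 τ u + (1 / 3) * iteratedDeriv 3 (theta τ) 0 / deriv (theta τ) 0

/-- Fourier coefficient along the horizontal line through `w`. -/
def fcoef (f : ℂ → ℂ) (j : ℤ) (w : ℂ) : ℂ :=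
  ∫ x in (0:ℝ)..1, f (x + w) * Complex.exp (-(2 * (Real.pi : ℂ) * I * j * (x + w)))

lemma fcoef_const (f : ℂ → ℂ) (hf : Differentiable ℂ f) (hp : ∀ z, f (z + 1) = f z) (j : ℤ)
    (w : ℂ) : fcoef f j w = fcoef f j 0 := by
  set g : ℂ → ℂ := fun z => f z * Complex.exp (-(2 * (Real.pi : ℂ) * I * j * z)) with hg
  have hgd : Differentiable ℂ g := by fun_prop
  have hgp : ∀ z, g (z + 1) = g z := by
    intro z
    simp only [hg, hp]
    congr 1
    rw [Complex.exp_eq_exp_iff_exists_int]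
    exact ⟨-j, by push_cast; ring⟩
  obtain ⟨G, hG⟩ := hgd.isExactOn_univ
  have hI : ∀ w, fcoef f j w = G (1 + w) - G w := by
    intro w
    have h1 : ∀ x ∈ Set.uIcc (0:ℝ) 1, HasDerivAt (fun x : ℝ => G (x + w)) (g (x + w)) x := by
      intro x _
      have h2 := hG ((x:ℂ) + w) (Set.mem_univ _)
      have h3 : HasDerivAt (fun y : ℂ => G (y + w)) (g (x + w)) (x:ℂ) := by
        simpa using h2.comp_add_const (x:ℂ) w
      exact h3.comp_ofReal
    have := intervalIntegral.integral_eq_sub_of_hasDerivAt h1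
      (by apply Continuous.intervalIntegrable
          have := hgd.continuous
          fun_prop)
    simpa [fcoef, hg] using this
  rw [hI, hI]
  have hd : ∀ z, HasDerivAt (fun w => G (1 + w) - G w) 0 z := by
    intro z
    have h2 := hG (1 + z) (Set.mem_univ _)
    have h3 : HasDerivAt (fun y : ℂ => G (1 + y)) (g (1 + z)) z := by
      simpa using h2.comp_const_add 1 z
    have := h3.sub (hG z (Set.mem_univ _))
    rwa [add_comm, hgp, sub_self] at this
  exact is_const_of_deriv_eq_zero (fun z => (hd z).differentiableAt) (fun z => (hd z).deriv) w 0

lemma eq_zero_of_fcoef (f : ℂ → ℂ) (hf : Continuous f) (hp : ∀ z, f (z + 1) = f z)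
    (h : ∀ j w, fcoef f j w = 0) (w : ℂ) : f w = 0 := by
  have hper : Function.Periodic (fun x : ℝ => f (x + w)) 1 := by
    intro x
    simp only [ofReal_add, ofReal_one]
    rw [← hp (x + w)]; congr 1; ring
  let F : C(AddCircle (1:ℝ), ℂ) := ⟨hper.lift, by
    have : Continuous (fun x : ℝ => f (x + w)) := by fun_prop
    exact continuous_coinduced_dom.mpr this⟩
  have hF : ∀ x : ℝ, F (x : AddCircle (1:ℝ)) = f (x + w) := fun x => hper.lift_coe x
  have hc : ∀ j, fourierCoeff F j = 0 := by
    intro j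
    rw [fourierCoeff_eq_intervalIntegral _ _ 0]
    have hj := h j w
    unfold fcoef at hj
    have : ∀ x : ℝ, (fourier (-j) (x : AddCircle (1:ℝ)) : ℂ) • F (x : AddCircle (1:ℝ)) =
       Complex.exp (2 * (Real.pi : ℂ) * I * j * w) *
        (f (x + w) * Complex.exp (-(2 * (Real.pi : ℂ) * I * j * (x + w)))) := by
      intro x
      rw [hF, fourier_coe_apply, smul_eq_mul, mul_left_comm, ← Complex.exp_add, mul_comm]
      congr 2
      push_cast; ring
    simp_rw [this]
    rw [zero_add, intervalIntegral.integral_const_mul, hj]; simp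
  have hs := has_pointwise_sum_fourier_series_of_summable (f := F)
    (by simp only [funext hc]; exact summable_zero) ((0:ℝ) : AddCircle (1:ℝ))
  simp only [hc, zero_smul] at hs
  have := hs.unique hasSum_zero
  rw [hF] at this
  simpa using this

/-- entire quasi-periodic functions of degree `k`. -/
structure QP (τ : ℂ) (k : ℕ) (C : ℂ) (f : ℂ → ℂ) : Prop where
  d : Differentiable ℂ f
  p : ∀ z, f (z + 1) = f z
  q : ∀ z, f (z + τ) = C * Complex.exp (-(2 * (Real.pi : ℂ) * I * k * z)) * f z

lemma QP.comb {τ : ℂ} {k : ℕ} {C : ℂ} {f g : ℂ → ℂ} (hf : QP τ k C f) (hg : QP τ k C g) (x y : ℂ) :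
    QP τ k C (fun z => x * f z + y * g z) := by
  have := hf.d
  have := hg.d
  refine ⟨by fun_prop, fun z => by simp only [hf.p, hg.p], fun z => ?_⟩
  simp only [hf.q, hg.q]; ring

lemma fcoef_comb {f g : ℂ → ℂ} (hf : Continuous f) (hg : Continuous g) (x y : ℂ) (j : ℤ) (w : ℂ) :
    fcoef (fun z => x * f z + y * g z) j w = x * fcoef f j w + y * fcoef g j w := by
  unfold fcoef
  rw [← intervalIntegral.integral_const_mul, ← intervalIntegral.integral_const_mul,
    ← intervalIntegral.integral_add]
  · congr 1; ext t; ring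
  all_goals apply Continuous.intervalIntegrable; fun_prop

lemma QP.step {τ : ℂ} {k : ℕ} {C : ℂ} {f : ℂ → ℂ} (hf : QP τ k C f) (j : ℤ) :
    fcoef f j 0 = C * Complex.exp (-(2 * (Real.pi : ℂ) * I * j * τ)) * fcoef f (j + k) 0 := by
  rw [← fcoef_const f hf.d hf.p j τ]
  unfold fcoef
  rw [← intervalIntegral.integral_const_mul]
  congr 1; ext x
  rw [hf.q]
  have : Complex.exp (-(2 * (Real.pi : ℂ) * I * j * (x + τ))) = 
    Complex.exp (-(2 * (Real.pi : ℂ) * I * j * τ)) * Complex.exp (-(2 * (Real.pi : ℂ) * I * j * x)) := by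
    rw [← Complex.exp_add]; congr 1; ring
  have h2 : Complex.exp (-(2 * (Real.pi : ℂ) * I * (j + k : ℤ) * (x + 0))) = 
    Complex.exp (-(2 * (Real.pi : ℂ) * I * k * x)) * Complex.exp (-(2 * (Real.pi : ℂ) * I * j * x)) := by
    rw [← Complex.exp_add]; congr 1; push_cast; ring
  rw [this, h2, add_zero]; ring

lemma QP.eq_zero {τ : ℂ} {k : ℕ} {C : ℂ} {f : ℂ → ℂ} (hf : QP τ k C f) (hk : 0 < k) (hC : C ≠ 0)
    (h0 : ∀ j : ℤ, 0 ≤ j → j < k → fcoef f j 0 = 0) (z : ℂ) : f z = 0 := by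
  have hiff : ∀ j : ℤ, fcoef f j 0 = 0 ↔ fcoef f (j + k) 0 = 0 := by
    intro j
    rw [hf.step j]
    simp [hC, Complex.exp_ne_zero]
  have hiff2 : ∀ (j m : ℤ), fcoef f j 0 = 0 ↔ fcoef f (j + m * k) 0 = 0 := by
    intro j m
    induction m using Int.induction_on with
    | zero => simp
    | succ i ih => rw [ih, hiff (j + i * k)]; ring_nf
    | pred i ih => rw [ih, hiff (j + (-i - 1) * k)]; ring_nf
  refine eq_zero_of_fcoef f hf.d.continuous hf.p (fun j w => ?_) z
  rw [fcoef_const f hf.d hf.p]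
  have hk' : (0:ℤ) < k := by exact_mod_cast hk
  have := (hiff2 (j % k) (j / k)).1 (h0 _ (Int.emod_nonneg _ hk'.ne') (Int.emod_lt_of_pos _ hk'))
  rwa [mul_comm, Int.emod_add_mul_ediv] at this

lemma QP.one_dim {τ C : ℂ} {f g : ℂ → ℂ} (hC : C ≠ 0) (hf : QP τ 1 C f) (hg : QP τ 1 C g)
    (z₀ : ℂ) (h0 : f z₀ ≠ 0) : ∃ c, ∀ z, g z = c * f z := by
  have key : ∀ z, fcoef g 0 0 * f z + (- fcoef f 0 0) * g z = 0 := by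
    refine (hf.comb hg _ _).eq_zero one_pos hC (fun j h1 h2 => ?_)
    obtain rfl : j = 0 := by norm_num at h2; omega
    rw [fcoef_comb hf.d.continuous hg.d.continuous]; ring
  have hne : fcoef f 0 0 ≠ 0 := by
    intro h
    refine h0 (hf.eq_zero one_pos hC (fun j h1 h2 => ?_) z₀)
    obtain rfl : j = 0 := by norm_num at h2; omega
    exact h
  refine ⟨fcoef g 0 0 / fcoef f 0 0, fun z => ?_⟩
  field_simp
  linear_combination - key z

lemma QP.two_dim {τ C : ℂ} {A B D : ℂ → ℂ} (hC : C ≠ 0) (hA : QP τ 2 C A) (hB : QP τ 2 C B)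
    (hD : QP τ 2 C D) (p q : ℂ) (hAp : A p = 0) (hBp : B p ≠ 0) (hDp : D p = 0)
    (hAq : A q ≠ 0) (hBq : B q = 0) (hDq : D q = 0) (z : ℂ) : D z = 0 := by
  have hjj : ∀ j : ℤ, 0 ≤ j → j < (2:ℕ) → j = 0 ∨ j = 1 := by
    intro j h1 h2; norm_num at h2; omega
  have ind : ∀ x y : ℂ, x * fcoef A 0 0 + y * fcoef B 0 0 = 0 →
      x * fcoef A 1 0 + y * fcoef B 1 0 = 0 → x = 0 ∧ y = 0 := by
    intro x y h1 h2
    have := (hA.comb hB x y).eq_zero two_pos hC (fun j hj hj' => by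
      rw [fcoef_comb hA.d.continuous hB.d.continuous]
      rcases hjj j hj hj' with rfl | rfl <;> assumption)
    constructor
    · simpa [hBq, hAq] using this q
    · simpa [hAp, hBp] using this p
  set a0 := fcoef A 0 0
  set a1 := fcoef A 1 0
  set b0 := fcoef B 0 0
  set b1 := fcoef B 1 0
  set d0 := fcoef D 0 0 with hd0
  set d1 := fcoef D 1 0 with hd1
  have hw : a0 * b1 - a1 * b0 ≠ 0 := by
    intro hw
    obtain ⟨h1, h2⟩ := ind b0 (-a0) (by ring) (by linear_combination -hw)
    obtain ⟨h3, h4⟩ := ind b1 (-a1) (by linear_combination hw) (by ring)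
    have := ind 1 0 (by linear_combination -h2) (by linear_combination -h4)
    exact one_ne_zero this.1
  have hAB := hA.comb hB (b0 * d1 - b1 * d0) (d0 * a1 - d1 * a0)
  have key := (hAB.comb hD 1 (a0 * b1 - a1 * b0)).eq_zero two_pos hC (fun j hj hj' => by
      rw [fcoef_comb hAB.d.continuous hD.d.continuous,
        fcoef_comb hA.d.continuous hB.d.continuous]
      rcases hjj j hj hj' with rfl | rfl
      · change 1 * (_ * a0 + _ * b0) + _ * d0 = 0
        ring
      · change 1 * (_ * a1 + _ * b1) + _ * d1 = 0
        ring)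
  have hy : d0 * a1 - d1 * a0 = 0 := by simpa [hAp, hBp, hDp] using key p
  have hx : b0 * d1 - b1 * d0 = 0 := by simpa [hAq, hBq, hDq] using key q
  simpa [hx, hy, hw] using key z

/-- q-Pochhammer product. -/
def qA (q x : ℂ) : ℂ := ∏' n : ℕ, (1 + -(q ^ n * x))

lemma qA_summable {q : ℂ} (hq : ‖q‖ < 1) (x : ℂ) : Summable (fun n : ℕ => ‖-(q ^ n * x)‖) := by
  simp only [norm_neg, norm_mul, norm_pow]
  exact (summable_geometric_of_lt_one (norm_nonneg _) hq).mul_right _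

lemma qA_diff {q : ℂ} (hq : ‖q‖ < 1) : Differentiable ℂ (qA q) := by
  intro x
  have hu : Summable (fun n : ℕ => ‖q‖ ^ n * (‖x‖ + 1)) :=
    (summable_geometric_of_lt_one (norm_nonneg _) hq).mul_right _
  have h := hu.hasProdLocallyUniformlyOn_nat_one_add (K := Metric.ball (0:ℂ) (‖x‖ + 1))
    (f := fun n x => -(q ^ n * x)) Metric.isOpen_ball
    (.of_forall fun n y hy => by
      simp only [norm_neg, norm_mul, norm_pow]
      have : ‖y‖ ≤ ‖x‖ + 1 := by simpa using (mem_ball_zero_iff.1 hy).le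
      gcongr) (fun n => by fun_prop)
  have h2 := h.differentiableOn
    (.of_forall fun _ ↦ by simpa [Finset.prod_fn] using
      DifferentiableOn.finsetProd (fun _ _ ↦ by fun_prop)) Metric.isOpen_ball
  exact h2.differentiableAt (Metric.isOpen_ball.mem_nhds (by simp))

lemma qA_step {q : ℂ} (hq : ‖q‖ < 1) (x : ℂ) : qA q x = (1 - x) * qA q (q * x) := by
  unfold qA
  have e : ∀ n : ℕ, 1 + -(q ^ (n + 1) * x) = 1 + -(q ^ n * (q * x)) := fun n => by ring
  rw [tprod_eq_zero_mul' (by simp only [e]; exact multipliable_one_add_of_summable (qA_summable hq _))]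
  simp only [e]
  simp [sub_eq_add_neg]

lemma qA_zero {q : ℂ} (hq : ‖q‖ < 1) {x : ℂ} (h : qA q x = 0) : ∃ n : ℕ, q ^ n * x = 1 := by
  by_contra! hn
  refine tprod_one_add_ne_zero_of_summable (f := fun n : ℕ => -(q ^ n * x)) (fun i hi => hn i ?_)
    (qA_summable hq x) h
  linear_combination -hi

lemma theta_eq (τ z : ℂ) : theta τ z =
    -(Complex.exp ((Real.pi : ℂ) * I * τ / 4 + (Real.pi : ℂ) * I * (z + 1 / 2)) *
      jacobiTheta₂ (z + 1 / 2 + τ / 2) τ) := by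
  unfold theta jacobiTheta₂ jacobiTheta₂_term
  rw [← tsum_mul_left]
  congr 2; ext j
  rw [← Complex.exp_add]; congr 1; ring

lemma exp_pi_I_add (a : ℂ) : Complex.exp (a + (Real.pi : ℂ) * I) = - Complex.exp a := by
  rw [Complex.exp_add, Complex.exp_pi_mul_I]; ring

lemma theta_diff {τ : ℂ} (hτ : 0 < τ.im) : Differentiable ℂ (theta τ) := by
  have h : Differentiable ℂ (fun z => jacobiTheta₂ z τ) :=
    fun z => differentiableAt_jacobiTheta₂_fst z hτ
  have h2 : Differentiable ℂ (fun z => jacobiTheta₂ (z + 1 / 2 + τ / 2) τ) :=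
    h.comp (by fun_prop : Differentiable ℂ (fun z : ℂ => z + 1 / 2 + τ / 2))
  rw [funext (theta_eq τ)]
  fun_prop

lemma theta_one (τ z : ℂ) : theta τ (z + 1) = - theta τ z := by
  rw [theta_eq, theta_eq, show z + 1 + 1 / 2 + τ / 2 = (z + 1 / 2 + τ / 2) + 1 by ring,
    jacobiTheta₂_add_left,
    show (Real.pi : ℂ) * I * τ / 4 + (Real.pi : ℂ) * I * (z + 1 + 1 / 2) =
      ((Real.pi : ℂ) * I * τ / 4 + (Real.pi : ℂ) * I * (z + 1 / 2)) + (Real.pi : ℂ) * I by ring,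
    exp_pi_I_add]
  ring

lemma theta_tau (τ z : ℂ) : theta τ (z + τ) =
    - Complex.exp (-((Real.pi : ℂ) * I * τ) - 2 * (Real.pi : ℂ) * I * z) * theta τ z := by
  rw [theta_eq, theta_eq, show z + τ + 1 / 2 + τ / 2 = (z + 1 / 2 + τ / 2) + τ by ring,
    jacobiTheta₂_add_left', ← exp_pi_I_add, mul_neg, ← mul_assoc, ← mul_assoc, ← Complex.exp_add,
    ← Complex.exp_add]
  congr 2
  rw [Complex.exp_eq_exp_iff_exists_int]
  exact ⟨-1, by push_cast; ring⟩

lemma theta_neg (τ z : ℂ) : theta τ (-z) = - theta τ z := by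
  rw [theta_eq, theta_eq, ← jacobiTheta₂_neg_left,
    show z + 1 / 2 + τ / 2 = -(-z + 1 / 2 + τ / 2) + 1 + τ by ring, jacobiTheta₂_add_left',
    jacobiTheta₂_add_left, neg_neg, ← mul_assoc, ← Complex.exp_add, ← neg_mul, ← exp_pi_I_add]
  congr 1
  rw [Complex.exp_eq_exp_iff_exists_int]
  exact ⟨1, by push_cast; ring⟩

lemma theta_zero (τ : ℂ) : theta τ 0 = 0 := by
  have := theta_neg τ 0
  rw [neg_zero] at this
  exact self_eq_neg.1 this

lemma theta_deriv_one (τ z : ℂ) : deriv (theta τ) (z + 1) = - deriv (theta τ) z := by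
  rw [← deriv_comp_add_const, funext (theta_one τ), deriv.fun_neg]

lemma theta_deriv_neg (τ z : ℂ) : deriv (theta τ) (-z) = deriv (theta τ) z := by
  have h := deriv_comp_neg (theta τ) z
  rw [funext (theta_neg τ), deriv.fun_neg] at h
  exact (neg_inj.1 h).symm

lemma theta_deriv_tau {τ : ℂ} (hτ : 0 < τ.im) (z : ℂ) : deriv (theta τ) (z + τ) =
    - Complex.exp (-((Real.pi : ℂ) * I * τ) - 2 * (Real.pi : ℂ) * I * z) *
      (deriv (theta τ) z - 2 * (Real.pi : ℂ) * I * theta τ z) := by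
  rw [← deriv_comp_add_const, funext (theta_tau τ)]
  have h1 : HasDerivAt (fun z : ℂ => -((Real.pi : ℂ) * I * τ) - 2 * (Real.pi : ℂ) * I * z)
      (-(2 * (Real.pi : ℂ) * I)) z := by
    simpa using ((hasDerivAt_id z).const_mul (2 * (Real.pi : ℂ) * I)).const_sub
      (-((Real.pi : ℂ) * I * τ))
  have := (h1.cexp.fun_neg.fun_mul (theta_diff hτ z).hasDerivAt).deriv
  rw [this]; ring

lemma theta_ne_zero {τ : ℂ} (hτ : 0 < τ.im) (z₀ : ℂ) (h0 : theta τ z₀ ≠ 0) (w : ℂ)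
    (hw : w ∉ Lam τ) : theta τ w ≠ 0 := by
  set q := Complex.exp (2 * (Real.pi : ℂ) * I * τ) with hqdef
  have hq : ‖q‖ < 1 := by
    rw [hqdef, Complex.norm_exp, Real.exp_lt_one_iff]
    simp
    positivity
  set e : ℂ → ℂ := fun z => Complex.exp (2 * (Real.pi : ℂ) * I * z) with he
  have hei : ∀ z, (e z)⁻¹ = Complex.exp (-(2 * (Real.pi : ℂ) * I * z)) := fun z =>
    (Complex.exp_neg _).symm
  have hene : ∀ z, e z ≠ 0 := fun z => Complex.exp_ne_zero _
  have he1 : ∀ z, e (z + 1) = e z := by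
    intro z
    simp only [he, mul_add, mul_one]
    exact Complex.exp_periodic _
  have heτ : ∀ z, e (z + τ) = q * e z := by
    intro z
    simp only [he, hqdef, mul_add, Complex.exp_add]; ring
  have hA := qA_diff hq
  have hP : QP τ 1 (-1) (fun z => qA q (e z) * qA q (q * (e z)⁻¹)) := by
    refine ⟨?_, fun z => by simp only [he1], fun z => ?_⟩
    · simp only [hei]
      refine (hA.comp (by fun_prop : Differentiable ℂ e)).fun_mul
        (hA.comp (by fun_prop : Differentiable ℂ
          (fun z => q * Complex.exp (-(2 * (Real.pi : ℂ) * I * z)))))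
    · simp only [heτ]
      have hq0 : q ≠ 0 := Complex.exp_ne_zero _
      rw [show q * (q * e z)⁻¹ = (e z)⁻¹ by field_simp, qA_step hq (e z)⁻¹, qA_step hq (e z),
        Nat.cast_one, mul_one, ← hei]
      have := hene z
      field_simp
      ring
  have hT : QP τ 1 (-1) (fun z => Complex.exp ((Real.pi : ℂ) * I * z) * theta τ z) := by
    have := theta_diff hτ
    refine ⟨by fun_prop, fun z => ?_, fun z => ?_⟩
    · rw [theta_one, mul_add, mul_one, exp_pi_I_add]; ring
    · rw [theta_tau, neg_mul, neg_mul, neg_mul, one_mul, mul_neg, ← mul_assoc, ← mul_assoc,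
        ← Complex.exp_add, ← Complex.exp_add]
      congr 3
      push_cast; ring
  obtain ⟨c, hc⟩ := hT.one_dim (by norm_num) hP z₀ (mul_ne_zero (Complex.exp_ne_zero _) h0)
  intro hw0
  have hz : qA q (e w) * qA q (q * (e w)⁻¹) = 0 := by
    have := hc w
    simpa [hw0] using this
  have hpi : 2 * (Real.pi : ℂ) * I ≠ 0 := Complex.two_pi_I_ne_zero
  apply hw
  rcases mul_eq_zero.1 hz with h | h
  · obtain ⟨n, hn⟩ := qA_zero hq h
    rw [hqdef, ← Complex.exp_nat_mul, he, ← Complex.exp_add, Complex.exp_eq_one_iff] at hn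
    obtain ⟨m, hm⟩ := hn
    refine ⟨m, -n, mul_left_cancel₀ hpi ?_⟩
    push_cast
    linear_combination hm
  · obtain ⟨n, hn⟩ := qA_zero hq h
    rw [hei, hqdef, ← Complex.exp_nat_mul, ← Complex.exp_add, ← Complex.exp_add,
      Complex.exp_eq_one_iff] at hn
    obtain ⟨m, hm⟩ := hn
    refine ⟨-m, n + 1, mul_left_cancel₀ hpi ?_⟩
    push_cast
    linear_combination -hm

/-- degenerate addition formula for the Kronecker function:
φ(z,u₁)·φ(z,u₂) = φ(z,u₁+u₂)·(E₁(z) + E₁(u₁) + E₁(u₂) − E₁(z+u₁+u₂)). -/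
theorem kronecker_degenerate_addition (τ : ℂ) (hτ : 0 < τ.im) (z u₁ u₂ : ℂ)
    (hz : z ∉ Lam τ) (hu₁ : u₁ ∉ Lam τ) (hu₂ : u₂ ∉ Lam τ)
    (hu₁₂ : u₁ + u₂ ∉ Lam τ) (hzu : z + u₁ + u₂ ∉ Lam τ) :
    phi τ z u₁ * phi τ z u₂ =
      phi τ z (u₁ + u₂) *
        (E1 τ z + E1 τ u₁ + E1 τ u₂ - E1 τ (z + u₁ + u₂)) := by
  by_cases hall : ∀ w, theta τ w = 0
  · simp [phi, hall]
  push Not at hall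
  obtain ⟨z₀, h0⟩ := hall
  have nz := theta_ne_zero hτ z₀ h0
  have hz' := nz z hz
  have h1' := nz u₁ hu₁
  have h2' := nz u₂ hu₂
  have h12' := nz _ hu₁₂
  have hs' := nz _ hzu
  have hθ := theta_diff hτ
  have hθ' : Differentiable ℂ (deriv (theta τ)) := hθ.contDiff.differentiable_deriv_two
  set m : ℂ → ℂ := fun z =>
    - Complex.exp (-((Real.pi : ℂ) * I * τ) - 2 * (Real.pi : ℂ) * I * z) with hm
  have hmm : ∀ z a b : ℂ, a + b = u₁ + u₂ → m (z + a) * m (z + b) =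
      Complex.exp (-(2 * (Real.pi : ℂ) * I * τ) - 2 * (Real.pi : ℂ) * I * (u₁ + u₂)) *
        Complex.exp (-(2 * (Real.pi : ℂ) * I * (2 : ℕ) * z)) := by
    intro z a b hab
    simp only [hm, neg_mul_neg, ← Complex.exp_add]
    congr 1
    push_cast
    linear_combination (-2 * (Real.pi : ℂ) * I) * hab
  have ht : ∀ z a, theta τ (z + τ + a) = m (z + a) * theta τ (z + a) := by
    intro z a
    rw [← theta_tau]; congr 1; ring
  have ht' : ∀ z a, deriv (theta τ) (z + τ + a) =
      m (z + a) * (deriv (theta τ) (z + a) - 2 * (Real.pi : ℂ) * I * theta τ (z + a)) := by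
    intro z a
    rw [← theta_deriv_tau hτ]; congr 1; ring
  have ho : ∀ z a, theta τ (z + 1 + a) = - theta τ (z + a) := by
    intro z a
    rw [← theta_one]; congr 1; ring
  have ho' : ∀ z a, deriv (theta τ) (z + 1 + a) = - deriv (theta τ) (z + a) := by
    intro z a
    rw [← theta_deriv_one]; congr 1; ring
  have hAB : ∀ a b : ℂ, a + b = u₁ + u₂ → QP τ 2
      (Complex.exp (-(2 * (Real.pi : ℂ) * I * τ) - 2 * (Real.pi : ℂ) * I * (u₁ + u₂)))
      (fun z => theta τ (z + a) * theta τ (z + b)) := by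
    intro a b hab
    refine ⟨by fun_prop, fun z => by simp only [ho]; ring, fun z => ?_⟩
    simp only [ht, ← hmm z a b hab]; ring
  have hE : QP τ 2
      (Complex.exp (-(2 * (Real.pi : ℂ) * I * τ) - 2 * (Real.pi : ℂ) * I * (u₁ + u₂)))
      (fun z => deriv (theta τ) (z + 0) * theta τ (z + (u₁ + u₂)) -
        theta τ (z + 0) * deriv (theta τ) (z + (u₁ + u₂))) := by
    refine ⟨by fun_prop, fun z => by simp only [ho, ho']; ring, fun z => ?_⟩
    simp only [ht, ht', ← hmm z 0 (u₁ + u₂) (by ring)]; ring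
  have hA := hAB 0 (u₁ + u₂) (by ring)
  have hB := hAB u₁ u₂ rfl
  have hD := (hE.comb hA (theta τ u₁ * theta τ u₂)
    (deriv (theta τ) u₁ * theta τ u₂ + theta τ u₁ * deriv (theta τ) u₂)).comb hB 1
      (-(deriv (theta τ) 0 * theta τ (u₁ + u₂)))
  have key := QP.two_dim (Complex.exp_ne_zero _) hA hB hD 0 (-u₁)
    (by simp [theta_zero]) (by simp [h1', h2']) (by simp [theta_zero]; ring)
    (by simp [theta_neg, h1', h2']) (by simp [theta_zero])
    (by simp [theta_zero, theta_neg, theta_deriv_neg]; ring) z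
  simp only [add_zero] at key
  rw [← add_assoc] at key
  simp only [phi, E1]
  rw [← add_assoc]
  field_simp
  linear_combination (-deriv (theta τ) 0) * key

end
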